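/- arXiv:2010.09770 — 3 statements merged into one kernel-verified Lean document; each statement's English description precedes it below -/
import Mathlib

section
/- Suppose the reward function takes values in {−1,+1}, and define the optimal action A* = R(X,A)·A. Then the expected score of the optimal action satisfies E[∇_w log π_w(X, A*)] = (1/2) E[(A·R(X,A) − (2σ(wᵀX) − 1)) X], where both expectations are over X ~ d₀ and A ~ π_w(X,·). -/
/-- The logistic sigmoid `σ(z) = 1/(1+exp(−z))`. -/
noncomputable def sig (z : ℝ) : ℝ := 1 / (1 + Real.exp (-z))

/-- Policy of a Bernoulli logistic unit with weight `w` on input `x`: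
`π_w(x,+1) = σ(wᵀx)` and `π_w(x,−1) = 1 − σ(wᵀx)`. -/
noncomputable def pol {n : ℕ} (w x : EuclideanSpace ℝ (Fin n)) (a : ℝ) : ℝ :=
  if a = 1 then sig (∑ k, w k * x k) else 1 - sig (∑ k, w k * x k)

theorem sig_hasDerivAt (z : ℝ) : HasDerivAt sig (sig z * (1 - sig z)) z := by
  have hp : (1 + Real.exp (-z)) ≠ 0 := by positivity
  have h1 : HasDerivAt (fun z : ℝ => 1 + Real.exp (-z)) (Real.exp (-z) * (-1)) z :=
    ((hasDerivAt_neg z).exp).const_add 1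
  have h2 := h1.inv hp
  have h3 : sig = (fun z : ℝ => 1 + Real.exp (-z))⁻¹ := by
    funext y
    simp [sig]
  rw [h3]
  refine h2.congr_deriv ?_
  simp only [Pi.inv_apply]
  field_simp
  ring

theorem sig_pos_aux (z : ℝ) : 0 < sig z := by
  unfold sig
  positivity

theorem sig_lt_one_aux (z : ℝ) : 0 < 1 - sig z := by
  have : 1 - sig z = Real.exp (-z) / (1 + Real.exp (-z)) := by
    unfold sig
    have hp : (1 + Real.exp (-z)) ≠ 0 := by positivity
    field_simp
    ring
  rw [this]
  positivity

theorem grad_comp_aux {n : ℕ} (w x : EuclideanSpace ℝ (Fin n)) (f : ℝ → ℝ) (c : ℝ)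
    (hf : HasDerivAt f c (∑ k, w k * x k)) :
    gradient (fun w' : EuclideanSpace ℝ (Fin n) => f (∑ k, w' k * x k)) w = c • x := by
  apply HasGradientAt.gradient
  rw [hasGradientAt_iff_hasFDerivAt]
  have he : ∀ w' : EuclideanSpace ℝ (Fin n), ∑ k, w' k * x k = innerSL ℝ x w' := by
    intro w'
    simp [PiLp.inner_apply]
  simp only [he] at hf ⊢
  have h := hf.comp_hasFDerivAt w (innerSL ℝ x).hasFDerivAt
  refine h.congr_fderiv ?_
  ext v
  simp [inner_smul_left]

theorem grad_pol_aux {n : ℕ} (w x : EuclideanSpace ℝ (Fin n)) (b : ℝ) (hb : b = 1 ∨ b = -1) :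
    gradient (fun w' : EuclideanSpace ℝ (Fin n) => Real.log (pol w' x b)) w
      = ((1 / 2 : ℝ) * (b - (2 * sig (∑ k, w k * x k) - 1))) • x := by
  have hs := sig_hasDerivAt (∑ k, w k * x k)
  have h0 := (sig_pos_aux (∑ k, w k * x k)).ne'
  have h1 := (sig_lt_one_aux (∑ k, w k * x k)).ne'
  rcases hb with rfl | rfl
  · simp only [pol, if_true]
    refine grad_comp_aux w x (fun z => Real.log (sig z)) _ ((hs.log h0).congr_deriv ?_)
    field_simp
    ring
  · have hne : ¬ ((-1 : ℝ) = 1) := by norm_num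
    simp only [pol, if_neg hne]
    refine grad_comp_aux w x (fun z => Real.log (1 - sig z)) _
      (((hs.const_sub 1).log h1).congr_deriv ?_)
    field_simp
    ring

/-- With rewards in `{−1,+1}` and optimal action `A* = R(X,A)·A`, the expected score of
the optimal action satisfies
`E[∇_w log π_w(X,A*)] = (1/2) E[(A·R(X,A) − (2σ(wᵀX)−1)) X]`,
where expectations are over `X ~ d₀` and `A ~ π_w(X,·)`. -/
theorem stmt2 (n : ℕ) (X : Finset (EuclideanSpace ℝ (Fin n)))
    (d0 : EuclideanSpace ℝ (Fin n) → ℝ)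
    (hd0 : ∀ x, 0 ≤ d0 x) (hd0sum : ∑ x ∈ X, d0 x = 1)
    (R : EuclideanSpace ℝ (Fin n) → ℝ → ℝ) (hR : ∀ x a, R x a = 1 ∨ R x a = -1)
    (w : EuclideanSpace ℝ (Fin n)) :
    ∑ x ∈ X, d0 x • ∑ a ∈ ({-1, 1} : Finset ℝ), pol w x a •
        gradient (fun w' : EuclideanSpace ℝ (Fin n) => Real.log (pol w' x (R x a * a))) w
      = (1 / 2 : ℝ) • ∑ x ∈ X, d0 x • ∑ a ∈ ({-1, 1} : Finset ℝ), pol w x a •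
          ((a * R x a - (2 * sig (∑ k, w k * x k) - 1)) • x) := by
  rw [Finset.smul_sum]
  refine Finset.sum_congr rfl fun x _ => ?_
  rw [smul_comm (1 / 2 : ℝ), Finset.smul_sum (r := (1 / 2 : ℝ))]
  congr 1
  refine Finset.sum_congr rfl fun a ha => ?_
  have hb : R x a * a = 1 ∨ R x a * a = -1 := by
    simp only [Finset.mem_insert, Finset.mem_singleton] at ha
    rcases ha with h | h <;> rcases hR x a with h' | h' <;> rw [h'] <;> rw [h] <;> norm_num
  rw [grad_pol_aux w x _ hb, smul_comm (1 / 2 : ℝ), smul_smul (1 / 2 : ℝ), mul_comm (R x a) a]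
end

section
/- In a layered stochastic network, for every layer l ∈ {1,…,L}, E[R(X,A) ∇_{W^l} log Pr(A | X; W) | π_W] = E[R(X,A) ∇_{W^l} log Pr(A | H^{l−1}; W) | π_W]; i.e., the state X in the REINFORCE estimator for layer l may be replaced by the previous layer's values H^{l−1}. -/
/-- Probability of a full trajectory `h` (state `h 0`, layers `h 1, …, h L`) of a layered
stochastic network with initial distribution `d0`, layer policies `P` and parameters `W`. -/
noncomputable def pTraj (L : ℕ) (H : ℕ → Type) (d : ℕ → ℕ)
    (P : (l : ℕ) → EuclideanSpace ℝ (Fin (d l)) → H l → H (l + 1) → ℝ)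
    (d0 : H 0 → ℝ)
    (W : (l : ℕ) → EuclideanSpace ℝ (Fin (d l)))
    (h : (l : Fin (L + 1)) → H l.1) : ℝ :=
  d0 (h ⟨0, Nat.succ_pos L⟩) *
    ∏ t : Fin L,
      P t.1 (W t.1) (h ⟨t.1, Nat.lt_succ_of_lt t.isLt⟩) (h ⟨t.1 + 1, Nat.succ_lt_succ t.isLt⟩)

/-- Conditional probability `Pr(A = a | X = x; W)` of the action given the state. -/
noncomputable def prAX (L : ℕ) (H : ℕ → Type) [∀ l, Fintype (H l)] [∀ l, DecidableEq (H l)]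
    (d : ℕ → ℕ)
    (P : (l : ℕ) → EuclideanSpace ℝ (Fin (d l)) → H l → H (l + 1) → ℝ)
    (d0 : H 0 → ℝ)
    (W : (l : ℕ) → EuclideanSpace ℝ (Fin (d l)))
    (x : H 0) (a : H L) : ℝ :=
  (∑ h : (l : Fin (L + 1)) → H l.1,
      if h ⟨0, Nat.succ_pos L⟩ = x ∧ h ⟨L, Nat.lt_succ_self L⟩ = a then
        pTraj L H d P d0 W h else 0) /
  (∑ h : (l : Fin (L + 1)) → H l.1,
      if h ⟨0, Nat.succ_pos L⟩ = x then pTraj L H d P d0 W h else 0)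

/-- Expected reward `J(W) = E[R(X,A) | π_W]` of the layered stochastic network. -/
noncomputable def Jnet (L : ℕ) (H : ℕ → Type) [∀ l, Fintype (H l)] (d : ℕ → ℕ)
    (P : (l : ℕ) → EuclideanSpace ℝ (Fin (d l)) → H l → H (l + 1) → ℝ)
    (d0 : H 0 → ℝ) (R : H 0 → H L → ℝ)
    (W : (l : ℕ) → EuclideanSpace ℝ (Fin (d l))) : ℝ :=
  ∑ h : (l : Fin (L + 1)) → H l.1,
    pTraj L H d P d0 W h * R (h ⟨0, Nat.succ_pos L⟩) (h ⟨L, Nat.lt_succ_self L⟩)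


/-- Conditional probability `Pr(A = a | H^{l0} = hm; W)` of the action given the value of
layer `l0`. -/
noncomputable def prAH (L : ℕ) (H : ℕ → Type) [∀ l, Fintype (H l)] [∀ l, DecidableEq (H l)]
    (d : ℕ → ℕ)
    (P : (l : ℕ) → EuclideanSpace ℝ (Fin (d l)) → H l → H (l + 1) → ℝ)
    (d0 : H 0 → ℝ)
    (W : (l : ℕ) → EuclideanSpace ℝ (Fin (d l)))
    (l0 : ℕ) (hl0 : l0 < L + 1) (hm : H l0) (a : H L) : ℝ :=
  (∑ h : (l : Fin (L + 1)) → H l.1,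
      if h ⟨l0, hl0⟩ = hm ∧ h ⟨L, Nat.lt_succ_self L⟩ = a then pTraj L H d P d0 W h else 0) /
  (∑ h : (l : Fin (L + 1)) → H l.1,
      if h ⟨l0, hl0⟩ = hm then pTraj L H d P d0 W h else 0)

/-- Extend a trajectory by one layer. -/
def snocT {L : ℕ} {H : ℕ → Type} (h : (l : Fin (L + 1)) → H l.1) (a : H (L + 1)) :
    (l : Fin (L + 1 + 1)) → H l.1 :=
  Fin.snoc (α := fun l : Fin (L + 1 + 1) => H l.1) h a

lemma snocT_lt {L : ℕ} {H : ℕ → Type} (h : (l : Fin (L + 1)) → H l.1) (a : H (L + 1))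
    (k : ℕ) (hk : k < L + 1) (hk' : k < L + 1 + 1) : snocT h a ⟨k, hk'⟩ = h ⟨k, hk⟩ :=
  Fin.snoc_castSucc (α := fun l : Fin (L + 1 + 1) => H l.1) a h ⟨k, hk⟩

lemma snocT_last {L : ℕ} {H : ℕ → Type} (h : (l : Fin (L + 1)) → H l.1) (a : H (L + 1))
    (hk' : L + 1 < L + 1 + 1) : snocT h a ⟨L + 1, hk'⟩ = a :=
  Fin.snoc_last (α := fun l : Fin (L + 1 + 1) => H l.1) a h

lemma sum_snocT {L : ℕ} {H : ℕ → Type} [∀ l, Fintype (H l)] {V : Type*} [AddCommMonoid V]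
    (f : ((l : Fin (L + 1 + 1)) → H l.1) → V) :
    ∑ h, f h = ∑ h : (l : Fin (L + 1)) → H l.1, ∑ a : H (L + 1), f (snocT h a) := by
  rw [Finset.sum_comm, ← Fintype.sum_prod_type']
  exact (Equiv.sum_comp (Fin.snocEquiv (fun l : Fin (L + 1 + 1) => H l.1)) f).symm

lemma pTraj_snocT (L : ℕ) (H : ℕ → Type) (d : ℕ → ℕ)
    (P : (l : ℕ) → EuclideanSpace ℝ (Fin (d l)) → H l → H (l + 1) → ℝ)
    (d0 : H 0 → ℝ) (W : (l : ℕ) → EuclideanSpace ℝ (Fin (d l)))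
    (h : (l : Fin (L + 1)) → H l.1) (a : H (L + 1)) :
    pTraj (L + 1) H d P d0 W (snocT h a) =
      pTraj L H d P d0 W h * P L (W L) (h ⟨L, Nat.lt_succ_self L⟩) a := by
  unfold pTraj
  rw [Fin.prod_univ_castSucc, ← mul_assoc]
  congr 1
  · congr 1
    refine Finset.prod_congr rfl fun t _ => ?_
    have h1 := snocT_lt h a t.1 (Nat.lt_succ_of_lt t.isLt) (by omega)
    have h2 := snocT_lt h a (t.1 + 1) (Nat.succ_lt_succ t.isLt) (by omega)
    simp only [Fin.val_castSucc]
    rw [h1, h2]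
  · have h1 := snocT_lt h a L (Nat.lt_succ_self L) (by omega)
    have h2 := snocT_last h a (by omega)
    simp only [Fin.val_last]
    rw [h1, h2]

/-- Transition kernel from layer `l0` to layer `l0 + n`. -/
noncomputable def Bk (H : ℕ → Type) [∀ l, Fintype (H l)] [∀ l, DecidableEq (H l)]
    (d : ℕ → ℕ)
    (P : (l : ℕ) → EuclideanSpace ℝ (Fin (d l)) → H l → H (l + 1) → ℝ)
    (W : (l : ℕ) → EuclideanSpace ℝ (Fin (d l))) (l0 : ℕ) (m : H l0) :
    (n : ℕ) → H (l0 + n) → ℝ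
  | 0 => fun a => if a = m then 1 else 0
  | n + 1 => fun a' => ∑ a : H (l0 + n), Bk H d P W l0 m n a * P (l0 + n) (W (l0 + n)) a a'

section
variable (H : ℕ → Type) [∀ l, Fintype (H l)] [∀ l, DecidableEq (H l)]
    (d : ℕ → ℕ)
    (P : (l : ℕ) → EuclideanSpace ℝ (Fin (d l)) → H l → H (l + 1) → ℝ)
    (d0 : H 0 → ℝ)
    (W : (l : ℕ) → EuclideanSpace ℝ (Fin (d l))) (l0 : ℕ)

lemma sum_traj {V : Type*} [AddCommGroup V] [Module ℝ V] (n : ℕ) :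
    ∀ f : H 0 → H l0 → H (l0 + n) → V,
    ∑ h : (l : Fin (l0 + n + 1)) → H l.1, pTraj (l0 + n) H d P d0 W h •
      f (h ⟨0, Nat.succ_pos _⟩) (h ⟨l0, by omega⟩) (h ⟨l0 + n, Nat.lt_succ_self _⟩)
    = ∑ g : (l : Fin (l0 + 1)) → H l.1, ∑ a : H (l0 + n),
      (pTraj l0 H d P d0 W g * Bk H d P W l0 (g ⟨l0, Nat.lt_succ_self _⟩) n a) •
      f (g ⟨0, Nat.succ_pos _⟩) (g ⟨l0, Nat.lt_succ_self _⟩) a := by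
  induction n with
  | zero =>
    intro f
    refine Finset.sum_congr rfl fun g _ => ?_
    simp only [Bk, mul_ite, mul_one, mul_zero, ite_smul, zero_smul]
    exact (Finset.sum_ite_eq' Finset.univ (g ⟨l0, Nat.lt_succ_self _⟩)
      (fun a => pTraj l0 H d P d0 W g • f (g ⟨0, Nat.succ_pos _⟩)
        (g ⟨l0, Nat.lt_succ_self _⟩) a)).symm ▸ by simp
  | succ n ih =>
    intro f
    have key := ih (fun x m a => ∑ a' : H (l0 + n + 1), P (l0 + n) (W (l0 + n)) a a' • f x m a')
    have e1 := sum_snocT (L := l0 + n) (H := H) (fun h => pTraj (l0 + n + 1) H d P d0 W h •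
      f (h ⟨0, Nat.succ_pos _⟩) (h ⟨l0, by omega⟩) (h ⟨l0 + n + 1, Nat.lt_succ_self _⟩))
    refine e1.trans ?_
    have e2 : ∀ (h : (l : Fin (l0 + n + 1)) → H l.1) (a : H (l0 + n + 1)),
        pTraj (l0 + n + 1) H d P d0 W (snocT h a) •
          f (snocT h a ⟨0, Nat.succ_pos _⟩) (snocT h a ⟨l0, by omega⟩)
            (snocT h a ⟨l0 + n + 1, Nat.lt_succ_self _⟩) =
        pTraj (l0 + n) H d P d0 W h • (P (l0 + n) (W (l0 + n)) (h ⟨l0 + n, Nat.lt_succ_self _⟩) a •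
          f (h ⟨0, Nat.succ_pos _⟩) (h ⟨l0, by omega⟩) a) := by
      intro h a
      rw [pTraj_snocT, snocT_lt h a 0 (by omega), snocT_lt h a l0 (by omega), snocT_last, smul_smul]
    simp only [e2, ← Finset.smul_sum]
    refine key.trans ?_
    refine Finset.sum_congr rfl fun g _ => ?_
    simp only [Finset.smul_sum]
    rw [Finset.sum_comm]
    refine Finset.sum_congr rfl fun a' _ => ?_
    simp only [Bk, Finset.mul_sum, Finset.sum_smul, smul_smul, mul_assoc]

lemma Bk_sum (hPsum : ∀ l w hh, ∑ hh', P l w hh hh' = 1) (m : H l0) (n : ℕ) :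
    ∑ a, Bk H d P W l0 m n a = 1 := by
  induction n with
  | zero => 
    simp only [Bk]
    exact (Finset.sum_ite_eq' Finset.univ m (fun _ => (1:ℝ))).trans (by simp)
  | succ n ih =>
    simp only [Bk]
    refine Finset.sum_comm.trans ?_
    simp only [← Finset.mul_sum]
    refine (Finset.sum_congr rfl fun a _ => ?_).trans ih
    rw [show ∑ i : H (l0 + (n + 1)), P (l0 + n) (W (l0 + n)) a i = 1 from hPsum _ _ _, mul_one]

lemma Bk_nonneg (hPpos : ∀ l w hh hh', 0 < P l w hh hh') (m : H l0) (n : ℕ) :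
    ∀ a, 0 ≤ Bk H d P W l0 m n a := by
  induction n with
  | zero => intro a; simp only [Bk]; split_ifs <;> norm_num
  | succ n ih =>
    intro a
    simp only [Bk]
    exact Finset.sum_nonneg fun b _ => mul_nonneg (ih b) (hPpos _ _ _ _).le

lemma Bk_pos (hPpos : ∀ l w hh hh', 0 < P l w hh hh')
    (hPsum : ∀ l w hh, ∑ hh', P l w hh hh' = 1) (m : H l0) (n : ℕ) (a) :
    0 < Bk H d P W l0 m (n + 1) a := by
  simp only [Bk]
  have h1 := Bk_sum H d P W l0 hPsum m n
  obtain ⟨b, _, hb⟩ : ∃ b ∈ Finset.univ, 0 < Bk H d P W l0 m n b :=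
    Finset.exists_lt_of_sum_lt (by simp [h1])
  exact Finset.sum_pos' (fun b _ => mul_nonneg (Bk_nonneg H d P W l0 hPpos m n b)
    (hPpos _ _ _ _).le) ⟨b, Finset.mem_univ _, mul_pos hb (hPpos _ _ _ _)⟩

lemma Bk_diff (hPdiff : ∀ l hh hh', Differentiable ℝ (fun w => P l w hh hh')) (m : H l0) (n : ℕ) :
    ∀ a, Differentiable ℝ (fun v => Bk H d P (Function.update W l0 v) l0 m n a) := by
  induction n with
  | zero => intro a; simp only [Bk]; exact differentiable_const _
  | succ n ih =>
    intro a
    simp only [Bk]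
    refine Differentiable.fun_sum fun b _ => (ih b).mul ?_
    have : ∀ k (y : H k) (z : H (k + 1)),
        Differentiable ℝ (fun v => P k (Function.update W l0 v k) y z) := by
      intro k y z
      by_cases hk : k = l0
      · subst hk; simpa using hPdiff k y z
      · simp [hk]
    exact this _ b a

lemma pTraj_update (v) (g : (l : Fin (l0 + 1)) → H l.1) :
    pTraj l0 H d P d0 (Function.update W l0 v) g = pTraj l0 H d P d0 W g := by
  unfold pTraj
  congr 1
  refine Finset.prod_congr rfl fun t _ => ?_
  rw [Function.update_of_ne (by have := t.isLt; omega)]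

lemma sum_den (hPsum : ∀ l w hh, ∑ hh', P l w hh hh' = 1) (n : ℕ) (φ : H 0 → H l0 → Prop)
    [∀ x m, Decidable (φ x m)] :
    (∑ h : (l : Fin (l0 + n + 1)) → H l.1,
      if φ (h ⟨0, Nat.succ_pos _⟩) (h ⟨l0, by omega⟩) then pTraj (l0 + n) H d P d0 W h else 0) =
    ∑ g : (l : Fin (l0 + 1)) → H l.1,
      if φ (g ⟨0, Nat.succ_pos _⟩) (g ⟨l0, Nat.lt_succ_self _⟩) then pTraj l0 H d P d0 W g else 0 := by
  have := sum_traj H d P d0 W l0 n (fun x m _ => if φ x m then (1:ℝ) else 0)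
  simp only [smul_eq_mul, mul_ite, mul_one, mul_zero] at this
  rw [this]
  refine Finset.sum_congr rfl fun g _ => ?_
  split_ifs
  · rw [← Finset.mul_sum, Bk_sum H d P W l0 hPsum, mul_one]
  · simp

lemma sum_num (n : ℕ) (φ : H 0 → H l0 → Prop) [∀ x m, Decidable (φ x m)] (a : H (l0 + n)) :
    (∑ h : (l : Fin (l0 + n + 1)) → H l.1,
      if φ (h ⟨0, Nat.succ_pos _⟩) (h ⟨l0, by omega⟩) ∧ h ⟨l0 + n, Nat.lt_succ_self _⟩ = a
        then pTraj (l0 + n) H d P d0 W h else 0) =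
    ∑ g : (l : Fin (l0 + 1)) → H l.1,
      if φ (g ⟨0, Nat.succ_pos _⟩) (g ⟨l0, Nat.lt_succ_self _⟩) then
        pTraj l0 H d P d0 W g * Bk H d P W l0 (g ⟨l0, Nat.lt_succ_self _⟩) n a else 0 := by
  have := sum_traj H d P d0 W l0 n (fun x m b => if φ x m ∧ b = a then (1:ℝ) else 0)
  simp only [smul_eq_mul, mul_ite, mul_one, mul_zero] at this
  rw [this]
  refine Finset.sum_congr rfl fun g _ => ?_
  split_ifs with h
  · simp only [h, true_and, Finset.sum_ite_eq', Finset.mem_univ, if_true]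
  · simp only [h, false_and, if_false, Finset.sum_const_zero]
end

lemma gradient_log_div {E : Type*} [NormedAddCommGroup E] [InnerProductSpace ℝ E] [CompleteSpace E]
    (f : E → ℝ) (w : E) (c : ℝ) (hc : c ≠ 0) (hf : DifferentiableAt ℝ f w) (h0 : f w ≠ 0) :
    gradient (fun v => Real.log (f v / c)) w = (f w)⁻¹ • gradient f w := by
  have h1 : HasFDerivAt (fun v => Real.log (f v / c)) ((f w)⁻¹ • fderiv ℝ f w) w := by
    have := (hf.hasFDerivAt.mul_const c⁻¹).log (mul_ne_zero h0 (inv_ne_zero hc))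
    simp only [← div_eq_mul_inv] at this
    convert this using 1
    rw [smul_smul]
    congr 1
    field_simp
  unfold gradient
  rw [h1.fderiv, map_smul]

lemma core {E : Type*} [NormedAddCommGroup E] [InnerProductSpace ℝ E] [CompleteSpace E]
    {G X A : Type*} [Fintype G] [Fintype X] [Fintype A] [DecidableEq X]
    (p : G → ℝ) (hp : ∀ g, 0 ≤ p g) (ξ : G → X) (b : G → A → E → ℝ) (w : E)
    (hb : ∀ g a, 0 < b g a w) (hd : ∀ g a, DifferentiableAt ℝ (b g a) w) (R : X → A → ℝ) :
    ∑ g, ∑ a, (p g * b g a w) • (R (ξ g) a • gradient (fun v => Real.log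
      ((∑ g', if ξ g' = ξ g then p g' * b g' a v else 0) / (∑ g', if ξ g' = ξ g then p g' else 0))) w)
    = ∑ g, ∑ a, (p g * b g a w) • (R (ξ g) a • gradient (fun v => Real.log (b g a v)) w) := by
  have hlog : ∀ g a, gradient (fun v => Real.log (b g a v)) w = (b g a w)⁻¹ • gradient (b g a) w := by
    intro g a
    have := gradient_log_div (b g a) w 1 one_ne_zero (hd g a) (hb g a).ne'
    simpa using this
  rw [Finset.sum_comm]
  conv_rhs => rw [Finset.sum_comm]
  refine Finset.sum_congr rfl fun a _ => ?_
  rw [← Finset.sum_fiberwise Finset.univ ξ]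
  conv_rhs => rw [← Finset.sum_fiberwise Finset.univ ξ]
  refine Finset.sum_congr rfl fun x _ => ?_
  set N : E → ℝ := fun v => ∑ g', if ξ g' = x then p g' * b g' a v else 0 with hN
  set D : ℝ := ∑ g', if ξ g' = x then p g' else 0 with hD
  have hDnn : ∀ g' ∈ Finset.univ, 0 ≤ if ξ g' = x then p g' else 0 := by
    intro g' _; split_ifs; exacts [hp _, le_rfl]
  have hNnn : ∀ g' ∈ Finset.univ, 0 ≤ if ξ g' = x then p g' * b g' a w else 0 := by
    intro g' _; split_ifs; exacts [mul_nonneg (hp _) (hb _ _).le, le_rfl]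
  by_cases hz : ∀ g, ξ g = x → p g = 0
  · rw [Finset.sum_eq_zero, Finset.sum_eq_zero]
    all_goals
      intro g hg
      rw [hz g (Finset.mem_filter.1 hg).2]; simp
  push Not at hz
  obtain ⟨g0, hg0, hpg0⟩ := hz
  have hpp : 0 < p g0 := lt_of_le_of_ne (hp g0) hpg0.symm
  have hDpos : 0 < D := Finset.sum_pos' hDnn ⟨g0, Finset.mem_univ _, by simp [hg0, hpp]⟩
  have hNpos : 0 < N w := Finset.sum_pos' hNnn ⟨g0, Finset.mem_univ _, by
    simp only [hg0, if_true]; exact mul_pos hpp (hb _ _)⟩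
  have hNd : HasFDerivAt N (∑ g', if ξ g' = x then p g' • fderiv ℝ (b g' a) w else 0) w := by
    refine HasFDerivAt.fun_sum fun g' _ => ?_
    split_ifs
    · exact (hd g' a).hasFDerivAt.const_mul (p g')
    · exact hasFDerivAt_const _ _
  have hg := gradient_log_div N w D hDpos.ne' hNd.differentiableAt hNpos.ne'
  have hgN : gradient N w = ∑ g' with ξ g' = x, p g' • gradient (b g' a) w := by
    unfold gradient
    rw [hNd.fderiv, ← Finset.sum_filter, map_sum]
    simp only [map_smul]
  have hL : ∀ g ∈ Finset.univ.filter (fun g => ξ g = x),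
      (p g * b g a w) • (R (ξ g) a • gradient (fun v => Real.log
      ((∑ g', if ξ g' = ξ g then p g' * b g' a v else 0) / (∑ g', if ξ g' = ξ g then p g' else 0))) w)
      = (p g * b g a w) • (R x a • ((N w)⁻¹ • gradient N w)) := by
    intro g hgx
    have := (Finset.mem_filter.1 hgx).2
    rw [this, ← hg]
  rw [Finset.sum_congr rfl hL, ← Finset.sum_smul, Finset.sum_filter]
  change N w • _ = _
  rw [smul_smul, smul_smul, mul_comm (N w), mul_assoc, mul_inv_cancel₀ hNpos.ne', mul_one]
  rw [hgN, Finset.smul_sum]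
  refine Finset.sum_congr rfl fun g hgx => ?_
  rw [hlog, (Finset.mem_filter.1 hgx).2]
  simp only [smul_smul]
  congr 1
  have := (hb g a).ne'
  field_simp

/-- In the layer-`l` REINFORCE estimator, the state `X` may be replaced by the previous
layer's values `H^{l−1}` (here: layer `l0`, for the transition `l0` into layer `l0+1`):
`E[R ∇_{W^l} log Pr(A|X;W)] = E[R ∇_{W^l} log Pr(A|H^{l−1};W)]`. -/
theorem stmt6 (L : ℕ) (hL : 0 < L) (H : ℕ → Type)
    [∀ l, Fintype (H l)] [∀ l, DecidableEq (H l)] [∀ l, Nonempty (H l)]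
    (d : ℕ → ℕ)
    (P : (l : ℕ) → EuclideanSpace ℝ (Fin (d l)) → H l → H (l + 1) → ℝ)
    (hPpos : ∀ l w hh hh', 0 < P l w hh hh')
    (hPsum : ∀ l w hh, ∑ hh', P l w hh hh' = 1)
    (hPdiff : ∀ l hh hh', Differentiable ℝ (fun w => P l w hh hh'))
    (d0 : H 0 → ℝ) (hd0 : ∀ x, 0 ≤ d0 x) (hd0sum : ∑ x, d0 x = 1)
    (R : H 0 → H L → ℝ)
    (W : (l : ℕ) → EuclideanSpace ℝ (Fin (d l)))
    (l0 : ℕ) (hl0 : l0 < L) :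
    ∑ h : (l : Fin (L + 1)) → H l.1,
        (pTraj L H d P d0 W h * R (h ⟨0, Nat.succ_pos L⟩) (h ⟨L, Nat.lt_succ_self L⟩)) •
          gradient (fun v =>
            Real.log (prAX L H d P d0 (Function.update W l0 v)
              (h ⟨0, Nat.succ_pos L⟩) (h ⟨L, Nat.lt_succ_self L⟩))) (W l0)
      = ∑ h : (l : Fin (L + 1)) → H l.1,
          (pTraj L H d P d0 W h * R (h ⟨0, Nat.succ_pos L⟩) (h ⟨L, Nat.lt_succ_self L⟩)) •
            gradient (fun v =>
              Real.log (prAH L H d P d0 (Function.update W l0 v) l0 (Nat.lt_succ_of_lt hl0)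
                (h ⟨l0, Nat.lt_succ_of_lt hl0⟩) (h ⟨L, Nat.lt_succ_self L⟩))) (W l0) := by
  obtain ⟨n, rfl⟩ : ∃ n, L = l0 + (n + 1) := ⟨L - l0 - 1, by omega⟩
  simp only [mul_smul]
  have hX : ∀ v x a, prAX (l0 + (n + 1)) H d P d0 (Function.update W l0 v) x a =
      (∑ g : (l : Fin (l0 + 1)) → H l.1, if g ⟨0, Nat.succ_pos _⟩ = x then
        pTraj l0 H d P d0 W g * Bk H d P (Function.update W l0 v) l0
          (g ⟨l0, Nat.lt_succ_self _⟩) (n + 1) a else 0) /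
      (∑ g : (l : Fin (l0 + 1)) → H l.1, if g ⟨0, Nat.succ_pos _⟩ = x then
        pTraj l0 H d P d0 W g else 0) := by
    intro v x a
    have h1 := sum_num H d P d0 (Function.update W l0 v) l0 (n + 1) (fun y _ => y = x) a
    have h2 := sum_den H d P d0 (Function.update W l0 v) l0 hPsum (n + 1) (fun y _ => y = x)
    simp only [pTraj_update] at h1 h2
    unfold prAX
    exact congrArg₂ (· / ·) h1 h2
  have hH : ∀ v m a, prAH (l0 + (n + 1)) H d P d0 (Function.update W l0 v) l0
        (Nat.lt_succ_of_lt hl0) m a =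
      (∑ g : (l : Fin (l0 + 1)) → H l.1, if g ⟨l0, Nat.lt_succ_self _⟩ = m then
        pTraj l0 H d P d0 W g * Bk H d P (Function.update W l0 v) l0
          (g ⟨l0, Nat.lt_succ_self _⟩) (n + 1) a else 0) /
      (∑ g : (l : Fin (l0 + 1)) → H l.1, if g ⟨l0, Nat.lt_succ_self _⟩ = m then
        pTraj l0 H d P d0 W g else 0) := by
    intro v x a
    have h1 := sum_num H d P d0 (Function.update W l0 v) l0 (n + 1) (fun _ y => y = x) a
    have h2 := sum_den H d P d0 (Function.update W l0 v) l0 hPsum (n + 1) (fun _ y => y = x)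
    simp only [pTraj_update] at h1 h2
    unfold prAH
    exact congrArg₂ (· / ·) h1 h2
  have hp : ∀ g : (l : Fin (l0 + 1)) → H l.1, 0 ≤ pTraj l0 H d P d0 W g := fun g =>
    mul_nonneg (hd0 _) (Finset.prod_nonneg fun _ _ => (hPpos _ _ _ _).le)
  have hcore := core (fun g : (l : Fin (l0 + 1)) → H l.1 => pTraj l0 H d P d0 W g) hp
    (fun g => g ⟨0, Nat.succ_pos _⟩)
    (fun g a v => Bk H d P (Function.update W l0 v) l0 (g ⟨l0, Nat.lt_succ_self _⟩) (n + 1) a)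
    (W l0) (fun g a => Bk_pos H d P _ l0 hPpos hPsum _ n a)
    (fun g a => (Bk_diff H d P W l0 hPdiff _ (n + 1) a).differentiableAt) R
  simp only [Function.update_eq_self] at hcore
  have hl := sum_traj H d P d0 W l0 (n + 1) (fun x _ a => R x a • gradient (fun v =>
    Real.log (prAX (l0 + (n + 1)) H d P d0 (Function.update W l0 v) x a)) (W l0))
  have hr := sum_traj H d P d0 W l0 (n + 1) (fun x m a => R x a • gradient (fun v =>
    Real.log (prAH (l0 + (n + 1)) H d P d0 (Function.update W l0 v) l0
      (Nat.lt_succ_of_lt hl0) m a)) (W l0))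
  refine hl.trans (Eq.trans ?_ hr.symm)
  simp only [hX]
  refine hcore.trans ?_
  refine Finset.sum_congr rfl fun g _ => Finset.sum_congr rfl fun a _ => ?_
  by_cases hg : pTraj l0 H d P d0 W g = 0
  · rw [hg]; simp
  congr 3
  funext v
  congr 1
  rw [hH]
  have hD : 0 < ∑ g' : (l : Fin (l0 + 1)) → H l.1,
      if g' ⟨l0, Nat.lt_succ_self _⟩ = g ⟨l0, Nat.lt_succ_self _⟩ then
        pTraj l0 H d P d0 W g' else 0 := by
    refine Finset.sum_pos' (fun g' _ => ?_) ⟨g, Finset.mem_univ _, ?_⟩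
    · split_ifs; exacts [hp _, le_rfl]
    · rw [if_pos rfl]; exact lt_of_le_of_ne (hp g) (Ne.symm hg)
  rw [eq_div_iff hD.ne', Finset.mul_sum]
  refine Finset.sum_congr rfl fun g' _ => ?_
  split_ifs with h
  · rw [h, mul_comm]
  · simp
end

section
/- In a layered stochastic network, for every layer l ∈ {1,…,L}, E[R(X,A) ∇_{W^l} log Pr(A | H^{l−1}; W) | π_W] = E[R(X,A) ∇_{W^l} log π_l(H^{l−1}, H^l; W^l) | π_W]; i.e., the action A in the REINFORCE estimator for layer l may be replaced by that layer's own output H^l, so applying REINFORCE to each layer with the same global reward is an unbiased estimator of the gradient of expected reward. -/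
section helpers

variable (L : ℕ) (H : ℕ → Type) [∀ l, Fintype (H l)] [∀ l, DecidableEq (H l)]
    (d : ℕ → ℕ)
    (P : (l : ℕ) → EuclideanSpace ℝ (Fin (d l)) → H l → H (l + 1) → ℝ)
    (d0 : H 0 → ℝ)
    (W : (l : ℕ) → EuclideanSpace ℝ (Fin (d l)))

theorem marg_step (hPsum : ∀ l w hh, ∑ hh', P l w hh hh' = 1) (k : ℕ) (hk : k < L + 1) (m : H k) :
    (∑ h : (l : Fin (L + 1 + 1)) → H l.1,
      if h ⟨k, Nat.lt_succ_of_lt hk⟩ = m then pTraj (L + 1) H d P d0 W h else 0) =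
    ∑ h : (l : Fin (L + 1)) → H l.1,
      if h ⟨k, hk⟩ = m then pTraj L H d P d0 W h else 0 := by
  rw [← (Fin.snocEquiv (fun l : Fin (L + 1 + 1) => H l.1)).sum_comp, Fintype.sum_prod_type_right]
  refine Finset.sum_congr rfl fun h _ => ?_
  have key : ∀ (x : H (L + 1)) (j : ℕ) (hj : j < L + 1),
      (Fin.snocEquiv (fun l : Fin (L + 1 + 1) => H l.1)) (x, h) ⟨j, Nat.lt_succ_of_lt hj⟩
        = h ⟨j, hj⟩ := by
    intro x j hj
    exact Fin.snoc_castSucc (α := fun l : Fin (L + 1 + 1) => H l.1) x h ⟨j, hj⟩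
  have key2 : ∀ (x : H (L + 1)),
      (Fin.snocEquiv (fun l : Fin (L + 1 + 1) => H l.1)) (x, h) ⟨L + 1, Nat.lt_succ_self _⟩
        = x := by
    intro x
    exact Fin.snoc_last (α := fun l : Fin (L + 1 + 1) => H l.1) x h
  have key3 : ∀ x : H (L + 1), pTraj (L + 1) H d P d0 W
      ((Fin.snocEquiv (fun l : Fin (L + 1 + 1) => H l.1)) (x, h)) =
      pTraj L H d P d0 W h * P L (W L) (h ⟨L, Nat.lt_succ_self L⟩) x := by
    intro x
    unfold pTraj
    rw [Fin.prod_univ_castSucc, ← mul_assoc]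
    congr 1
    · refine congrArg₂ (fun a b : ℝ => a * b) (congrArg d0 (key x 0 (Nat.succ_pos L))) ?_
      refine Finset.prod_congr rfl fun t _ => ?_
      exact congrArg₂ (P t.1 (W t.1)) (key x t.1 (Nat.lt_succ_of_lt t.isLt))
        (key x (t.1 + 1) (Nat.succ_lt_succ t.isLt))
    · exact congrArg₂ (P L (W L)) (key x L (Nat.lt_succ_self L)) (key2 x)
  by_cases hm : h ⟨k, hk⟩ = m
  · rw [if_pos hm]
    calc _ = ∑ x : H (L + 1), pTraj L H d P d0 W h * P L (W L) (h ⟨L, Nat.lt_succ_self L⟩) x := by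
          refine Finset.sum_congr rfl fun x _ => ?_
          rw [if_pos ((key x k hk).trans hm), key3 x]
      _ = _ := by rw [← Finset.mul_sum, hPsum, mul_one]
  · rw [if_neg hm]
    refine Finset.sum_eq_zero fun x _ => ?_
    rw [if_neg]
    rw [key x k hk]
    exact hm

theorem marg (hPsum : ∀ l w hh, ∑ hh', P l w hh hh' = 1) (k : ℕ) (m : H k) (hk : k < L + 1) :
    (∑ h : (l : Fin (L + 1)) → H l.1,
      if h ⟨k, hk⟩ = m then pTraj L H d P d0 W h else 0) =
    ∑ h : (l : Fin (k + 1)) → H l.1,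
      if h ⟨k, Nat.lt_succ_self k⟩ = m then pTraj k H d P d0 W h else 0 := by
  induction L with
  | zero =>
    obtain rfl : k = 0 := by omega
    rfl
  | succ n ih =>
    by_cases h : k < n + 1
    · rw [← ih h]
      exact marg_step n H d P d0 W hPsum k h m
    · obtain rfl : k = n + 1 := by omega
      rfl

theorem marg_const (hPsum : ∀ l w hh, ∑ hh', P l w hh hh' = 1) (k : ℕ) (m : H k) (hk : k < L + 1)
    (v : EuclideanSpace ℝ (Fin (d k))) :
    (∑ h : (l : Fin (L + 1)) → H l.1,
      if h ⟨k, hk⟩ = m then pTraj L H d P d0 (Function.update W k v) h else 0) =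
    ∑ h : (l : Fin (L + 1)) → H l.1,
      if h ⟨k, hk⟩ = m then pTraj L H d P d0 W h else 0 := by
  rw [marg L H d P d0 _ hPsum, marg L H d P d0 _ hPsum]
  refine Finset.sum_congr rfl fun h _ => ?_
  have e : pTraj k H d P d0 (Function.update W k v) h = pTraj k H d P d0 W h := by
    unfold pTraj
    congr 1
    refine Finset.prod_congr rfl fun t _ => ?_
    rw [Function.update_of_ne (ne_of_lt t.isLt)]
  rw [e]

theorem pTraj_grad (hPpos : ∀ l w hh hh', 0 < P l w hh hh')
    (hPdiff : ∀ l hh hh', Differentiable ℝ (fun w => P l w hh hh'))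
    (k : ℕ) (hk : k < L) (h : (l : Fin (L + 1)) → H l.1) :
    HasGradientAt (fun v => pTraj L H d P d0 (Function.update W k v) h)
      (pTraj L H d P d0 W h • gradient (fun v =>
              Real.log (P k v (h ⟨k, Nat.lt_succ_of_lt hk⟩)
                (h ⟨k + 1, Nat.succ_lt_succ hk⟩))) (W k)) (W k) := by
  set f := fun v => P k v (h ⟨k, Nat.lt_succ_of_lt hk⟩) (h ⟨k + 1, Nat.succ_lt_succ hk⟩) with hf
  obtain ⟨C, hC⟩ : ∃ C : ℝ, ∀ v, pTraj L H d P d0 (Function.update W k v) h = C * f v := by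
    refine ⟨d0 (h ⟨0, Nat.succ_pos L⟩) * ∏ t ∈ Finset.univ.erase (⟨k, hk⟩ : Fin L),
      P t.1 (W t.1) (h ⟨t.1, Nat.lt_succ_of_lt t.isLt⟩)
        (h ⟨t.1 + 1, Nat.succ_lt_succ t.isLt⟩), fun v => ?_⟩
    unfold pTraj
    rw [← Finset.prod_erase_mul _ _ (Finset.mem_univ (⟨k, hk⟩ : Fin L)), ← mul_assoc]
    congr 1
    · congr 1
      refine Finset.prod_congr rfl fun t ht => ?_
      have : t.1 ≠ k := fun e => (Finset.ne_of_mem_erase ht) (Fin.ext e)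
      rw [Function.update_of_ne this]
    · simp [hf]
  have hW : pTraj L H d P d0 W h = C * f (W k) := by
    rw [← hC, Function.update_eq_self]
  have hfp : 0 < f (W k) := hPpos _ _ _ _
  have hfd : HasFDerivAt f (fderiv ℝ f (W k)) (W k) := (hPdiff _ _ _ _).hasFDerivAt
  have hlog : HasFDerivAt (fun v => Real.log (f v)) _ (W k) := hfd.log hfp.ne'
  have hg : HasFDerivAt (fun v => Real.log (f v)) _ (W k) :=
    (hlog.differentiableAt.hasGradientAt).hasFDerivAt
  rw [hasGradientAt_iff_hasFDerivAt]
  change HasFDerivAt _ ((InnerProductSpace.toDual ℝ _)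
    (pTraj L H d P d0 W h • gradient (fun v => Real.log (f v)) (W k))) _
  rw [map_smul, ← hlog.unique hg, hW, smul_smul, mul_assoc, mul_inv_cancel₀ hfp.ne', mul_one]
  simp_rw [hC]
  exact hfd.const_mul C

/-- Splice two trajectories at layer `k`. -/
def splice (k : ℕ) (h h' : (l : Fin (L + 1)) → H l.1) : (l : Fin (L + 1)) → H l.1 :=
  fun l => if l.1 ≤ k then h l else h' l

theorem splice_mul (k : ℕ) (hk : k < L) (h h' : (l : Fin (L + 1)) → H l.1)
    (e : h ⟨k, Nat.lt_succ_of_lt hk⟩ = h' ⟨k, Nat.lt_succ_of_lt hk⟩) :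
    pTraj L H d P d0 W (splice L H k h h') * pTraj L H d P d0 W (splice L H k h' h) =
      pTraj L H d P d0 W h * pTraj L H d P d0 W h' := by
  unfold pTraj
  rw [mul_mul_mul_comm, mul_mul_mul_comm (d0 (h ⟨0, Nat.succ_pos L⟩)), ← Finset.prod_mul_distrib,
    ← Finset.prod_mul_distrib]
  congr 1
  refine Finset.prod_congr rfl fun t _ => ?_
  obtain ⟨t, ht⟩ := t
  rcases lt_trichotomy t k with h1 | h1 | h1
  · simp only [splice, if_pos h1.le, if_pos (Nat.succ_le_of_lt h1)]
  · subst h1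
    simp only [splice, le_refl, if_true, Nat.not_succ_le_self, if_false]
    rw [e, mul_comm]
  · simp only [splice, if_neg (not_le.mpr h1), if_neg (not_le.mpr (h1.trans (Nat.lt_succ_self t)))]
    rw [mul_comm]

theorem splice_splice (k : ℕ) (h h' : (l : Fin (L + 1)) → H l.1) :
    splice L H k (splice L H k h h') (splice L H k h' h) = h := by
  funext l
  simp only [splice]
  split_ifs <;> rfl

end helpers

/-- In the layer-`l` REINFORCE estimator, the action `A` may be replaced by that layer's
own output (here: for the transition `l0`, by the value of layer `l0+1`):
`E[R ∇_{W^l} log Pr(A|H^{l−1};W)] = E[R ∇_{W^l} log π_l(H^{l−1},H^l;W^l)]`, so applying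
REINFORCE to each layer with the same global reward is an unbiased gradient estimator. -/
theorem stmt7 (L : ℕ) (hL : 0 < L) (H : ℕ → Type)
    [∀ l, Fintype (H l)] [∀ l, DecidableEq (H l)] [∀ l, Nonempty (H l)]
    (d : ℕ → ℕ)
    (P : (l : ℕ) → EuclideanSpace ℝ (Fin (d l)) → H l → H (l + 1) → ℝ)
    (hPpos : ∀ l w hh hh', 0 < P l w hh hh')
    (hPsum : ∀ l w hh, ∑ hh', P l w hh hh' = 1)
    (hPdiff : ∀ l hh hh', Differentiable ℝ (fun w => P l w hh hh'))
    (d0 : H 0 → ℝ) (hd0 : ∀ x, 0 ≤ d0 x) (hd0sum : ∑ x, d0 x = 1)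
    (R : H 0 → H L → ℝ)
    (W : (l : ℕ) → EuclideanSpace ℝ (Fin (d l)))
    (l0 : ℕ) (hl0 : l0 < L) :
    ∑ h : (l : Fin (L + 1)) → H l.1,
        (pTraj L H d P d0 W h * R (h ⟨0, Nat.succ_pos L⟩) (h ⟨L, Nat.lt_succ_self L⟩)) •
          gradient (fun v =>
            Real.log (prAH L H d P d0 (Function.update W l0 v) l0 (Nat.lt_succ_of_lt hl0)
              (h ⟨l0, Nat.lt_succ_of_lt hl0⟩) (h ⟨L, Nat.lt_succ_self L⟩))) (W l0)
      = ∑ h : (l : Fin (L + 1)) → H l.1,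
          (pTraj L H d P d0 W h * R (h ⟨0, Nat.succ_pos L⟩) (h ⟨L, Nat.lt_succ_self L⟩)) •
            gradient (fun v =>
              Real.log (P l0 v (h ⟨l0, Nat.lt_succ_of_lt hl0⟩)
                (h ⟨l0 + 1, Nat.succ_lt_succ hl0⟩))) (W l0) := by
  classical
  have hk1 : l0 < L + 1 := Nat.lt_succ_of_lt hl0
  set p : ((l : Fin (L + 1)) → H l.1) → ℝ := fun h => pTraj L H d P d0 W h with hp
  set s : ((l : Fin (L + 1)) → H l.1) → EuclideanSpace ℝ (Fin (d l0)) := fun h =>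
    gradient (fun v => Real.log (P l0 v (h ⟨l0, Nat.lt_succ_of_lt hl0⟩)
                (h ⟨l0 + 1, Nat.succ_lt_succ hl0⟩))) (W l0) with hs
  set r : ((l : Fin (L + 1)) → H l.1) → ℝ := fun h =>
    R (h ⟨0, Nat.succ_pos L⟩) (h ⟨L, Nat.lt_succ_self L⟩) with hr
  have hp0 : ∀ W h, 0 ≤ pTraj L H d P d0 W h := fun W h =>
    mul_nonneg (hd0 _) (Finset.prod_nonneg fun t _ => (hPpos _ _ _ _).le)
  let C : ((l : Fin (L + 1)) → H l.1) → ((l : Fin (L + 1)) → H l.1) → Prop := fun h h' =>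
    h' ⟨l0, hk1⟩ = h ⟨l0, hk1⟩ ∧ h' ⟨L, Nat.lt_succ_self L⟩ = h ⟨L, Nat.lt_succ_self L⟩
  let N : ((l : Fin (L + 1)) → H l.1) → ℝ := fun h => ∑ h', if C h h' then p h' else 0
  have hNp : ∀ h, p h ≤ N h := by
    intro h
    have := Finset.single_le_sum (f := fun h' => if C h h' then p h' else 0)
      (fun h' _ => by split_ifs; exacts [hp0 _ _, le_rfl]) (Finset.mem_univ h)
    simpa [C] using this
  have hgrad : ∀ h, p h ≠ 0 → gradient (fun v =>
            Real.log (prAH L H d P d0 (Function.update W l0 v) l0 (Nat.lt_succ_of_lt hl0)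
              (h ⟨l0, Nat.lt_succ_of_lt hl0⟩) (h ⟨L, Nat.lt_succ_self L⟩))) (W l0)
      = (N h)⁻¹ • ∑ h', if C h h' then p h' • s h' else 0 := by
    intro h hph
    have hpos : 0 < p h := lt_of_le_of_ne (hp0 _ _) (Ne.symm hph)
    have hNpos : 0 < N h := hpos.trans_le (hNp h)
    set D : ℝ := ∑ h' : (l : Fin (L + 1)) → H l.1,
      if h' ⟨l0, hk1⟩ = h ⟨l0, hk1⟩ then pTraj L H d P d0 W h' else 0 with hD
    have hDpos : 0 < D := by
      refine hpos.trans_le ?_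
      have := Finset.single_le_sum (f := fun h' : (l : Fin (L + 1)) → H l.1 =>
        if h' ⟨l0, hk1⟩ = h ⟨l0, hk1⟩ then pTraj L H d P d0 W h' else 0)
        (fun h' _ => by split_ifs; exacts [hp0 _ _, le_rfl]) (Finset.mem_univ h)
      simpa using this
    apply HasGradientAt.gradient
    rw [hasGradientAt_iff_hasFDerivAt]
    have hNd : HasFDerivAt (fun v => ∑ h' : (l : Fin (L + 1)) → H l.1,
        if C h h' then pTraj L H d P d0 (Function.update W l0 v) h' else 0)
        (∑ h' : (l : Fin (L + 1)) → H l.1, InnerProductSpace.toDual ℝ _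
          (if C h h' then p h' • s h' else 0)) (W l0) := by
      refine HasFDerivAt.fun_sum fun h' _ => ?_
      by_cases hc : C h h'
      · simp only [if_pos hc]
        exact (pTraj_grad L H d P d0 W hPpos hPdiff l0 hl0 h').hasFDerivAt
      · simp only [if_neg hc, map_zero]
        exact hasFDerivAt_const _ _
    have hval : (∑ h' : (l : Fin (L + 1)) → H l.1,
        if C h h' then pTraj L H d P d0 (Function.update W l0 (W l0)) h' else 0) = N h := by
      rw [Function.update_eq_self]
    have h2 := (hNd.mul_const D⁻¹).log (by
      rw [hval]; exact (mul_pos hNpos (inv_pos.mpr hDpos)).ne')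
    rw [hval] at h2
    have e1 : (fun v =>
            Real.log (prAH L H d P d0 (Function.update W l0 v) l0 (Nat.lt_succ_of_lt hl0)
              (h ⟨l0, Nat.lt_succ_of_lt hl0⟩) (h ⟨L, Nat.lt_succ_self L⟩))) =
        fun v => Real.log ((∑ h' : (l : Fin (L + 1)) → H l.1,
          if C h h' then pTraj L H d P d0 (Function.update W l0 v) h' else 0) * D⁻¹) := by
      funext v
      congr 1
      unfold prAH
      rw [marg_const L H d P d0 W hPsum, ← hD, div_eq_mul_inv]
    have e2 : (N h * D⁻¹)⁻¹ * D⁻¹ = (N h)⁻¹ := by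
      field_simp
    rw [smul_smul, e2] at h2
    rw [e1, map_smul, map_sum]
    exact h2
  let B : ((l : Fin (L + 1)) → H l.1) × ((l : Fin (L + 1)) → H l.1) →
      ((l : Fin (L + 1)) → H l.1) × ((l : Fin (L + 1)) → H l.1) :=
    fun x => (splice L H l0 x.1 x.2, splice L H l0 x.2 x.1)
  have hB : Function.Involutive B := fun x =>
    Prod.ext (splice_splice L H l0 x.1 x.2) (splice_splice L H l0 x.2 x.1)
  have hs0 : ∀ h h', splice L H l0 h h' ⟨0, Nat.succ_pos L⟩ = h ⟨0, Nat.succ_pos L⟩ :=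
    fun h h' => if_pos (Nat.zero_le _)
  have hsk : ∀ h h', splice L H l0 h h' ⟨l0, hk1⟩ = h ⟨l0, hk1⟩ :=
    fun h h' => if_pos le_rfl
  have hsk1 : ∀ h h', splice L H l0 h h' ⟨l0 + 1, Nat.succ_lt_succ hl0⟩
      = h' ⟨l0 + 1, Nat.succ_lt_succ hl0⟩ :=
    fun h h' => if_neg (Nat.not_succ_le_self _)
  have hsL : ∀ h h', splice L H l0 h h' ⟨L, Nat.lt_succ_self L⟩ = h' ⟨L, Nat.lt_succ_self L⟩ :=
    fun h h' => if_neg (not_le.mpr hl0)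
  calc _ = ∑ h, ∑ h', if C h h' then (p h * p h' * (r h * (N h)⁻¹)) • s h' else 0 := by
        refine Finset.sum_congr rfl fun h _ => ?_
        by_cases hph : p h = 0
        · have : pTraj L H d P d0 W h = 0 := hph
          simp [hph, this]
        · rw [hgrad h hph, smul_smul, Finset.smul_sum]
          refine Finset.sum_congr rfl fun h' _ => ?_
          rw [smul_ite, smul_zero, smul_smul]
          congr 2
          simp only [hp, hr]
          ring
    _ = ∑ h, ∑ h', if C h h' then (p h * p h' * (r h * (N h)⁻¹)) • s h else 0 := by
        rw [← Fintype.sum_prod_type', ← Fintype.sum_prod_type']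
        refine Fintype.sum_equiv hB.toPerm _ _ fun x => ?_
        obtain ⟨h, h'⟩ := x
        change _ = if C (splice L H l0 h h') (splice L H l0 h' h) then
          (p (splice L H l0 h h') * p (splice L H l0 h' h) * (r (splice L H l0 h h') *
            (N (splice L H l0 h h'))⁻¹)) • s (splice L H l0 h h') else 0
        have hCiff : C (splice L H l0 h h') (splice L H l0 h' h) ↔ C h h' := by
          simp only [C, hsk, hsL]
          exact and_congr_right fun _ => eq_comm
        by_cases hc : C h h'
        · rw [if_pos hc, if_pos (hCiff.mpr hc)]
          have e1 : p (splice L H l0 h h') * p (splice L H l0 h' h) = p h * p h' :=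
            splice_mul L H d P d0 W l0 hl0 h h' hc.1.symm
          have e2 : r (splice L H l0 h h') = r h := by
            simp only [hr, hs0, hsL, hc.2]
          have e3 : N (splice L H l0 h h') = N h := by
            simp only [N, C, hsk, hsL, hc.2]
          have e4 : s (splice L H l0 h h') = s h' := by
            simp only [hs, hsk, hsk1, hc.1]
          rw [e1, e2, e3, e4]
        · rw [if_neg hc, if_neg (fun q => hc (hCiff.mp q))]
    _ = _ := by
        refine Finset.sum_congr rfl fun h _ => ?_
        by_cases hph : p h = 0
        · have : pTraj L H d P d0 W h = 0 := hph
          simp [hph, this]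
        · have hpos : 0 < p h := lt_of_le_of_ne (hp0 _ _) (Ne.symm hph)
          have hNpos : 0 < N h := hpos.trans_le (hNp h)
          have : ∀ h', (if C h h' then (p h * p h' * (r h * (N h)⁻¹)) • s h else 0)
              = ((if C h h' then p h' else 0) * (p h * r h * (N h)⁻¹)) • s h := by
            intro h'
            split_ifs
            · congr 1; ring
            · simp
          simp_rw [this]
          rw [← Finset.sum_smul, ← Finset.sum_mul]
          change (N h * (p h * r h * (N h)⁻¹)) • s h = (p h * r h) • s h
          congr 1
          field_simp
end
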